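/- arXiv:1702.08840 — 2 statements merged into one kernel-verified Lean document; each statement's English description precedes it below -/
import Mathlib

section
/- Let d ≥ 1 and ℓ ≥ 1. For every prior mean ν ∈ ℝ^d, prior variance τ² > 0 and variances s = (s_1,…,s_ℓ) ∈ (0,∞)^ℓ, the function y ↦ C(y, s) is a probability density on (ℝ^d)^ℓ, i.e., ∫_{(ℝ^d)^ℓ} C(y, s) dy = 1. -/
open MeasureTheory ProbabilityTheory Real

noncomputable section

/-- Density of the spherical Gaussian on `ℝ^d` with mean `m` and per-coordinate variance `s`:
`φ(x | m, s) = (2πs)^{-d/2} exp(-‖x-m‖²/(2s))`. -/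
def phi (d : ℕ) (x m : EuclideanSpace ℝ (Fin d)) (s : ℝ) : ℝ :=
  (2 * π * s) ^ (-(d : ℝ) / 2) * Real.exp (-‖x - m‖ ^ 2 / (2 * s))

/-- The spherical Gaussian measure on `ℝ^d` with mean `m` and per-coordinate variance `s`,
defined by its density w.r.t. Lebesgue measure. -/
def sphericalGaussian (d : ℕ) (m : EuclideanSpace ℝ (Fin d)) (s : ℝ) :
    Measure (EuclideanSpace ℝ (Fin d)) :=
  volume.withDensity fun x => ENNReal.ofReal (phi d x m s)

/-- Posterior variance `σ̄²(s) = (1/τ² + Σ_u 1/s_u)⁻¹`. -/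
def sbar (ℓ : ℕ) (τ2 : ℝ) (s : Fin ℓ → ℝ) : ℝ :=
  (1 / τ2 + ∑ u, 1 / s u)⁻¹

/-- Posterior mean `μ̄(y, s) = σ̄²(s) • (ν/τ² + Σ_u y_u/s_u)`. -/
def mubar (d ℓ : ℕ) (ν : EuclideanSpace ℝ (Fin d)) (τ2 : ℝ)
    (y : Fin ℓ → EuclideanSpace ℝ (Fin d)) (s : Fin ℓ → ℝ) : EuclideanSpace ℝ (Fin d) :=
  sbar ℓ τ2 s • ((1 / τ2) • ν + ∑ u, (1 / s u) • y u)

/-- Exponent `D(y,s) = (σ̄²(s)/2) (Σ_u ‖y_u-ν‖²/(s_u τ²) + Σ_{u<v} ‖y_u-y_v‖²/(s_u s_v))`. -/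
def Dfac (d ℓ : ℕ) (ν : EuclideanSpace ℝ (Fin d)) (τ2 : ℝ)
    (y : Fin ℓ → EuclideanSpace ℝ (Fin d)) (s : Fin ℓ → ℝ) : ℝ :=
  sbar ℓ τ2 s / 2 *
    (∑ u, ‖y u - ν‖ ^ 2 / (s u * τ2) +
      ∑ u, ∑ v, if u < v then ‖y u - y v‖ ^ 2 / (s u * s v) else 0)

/-- Normalization factor
`C(y,s) = (σ̄²(s) / (τ² ∏_u 2π s_u))^{d/2} exp(-D(y,s))`. -/
def Cfac (d ℓ : ℕ) (ν : EuclideanSpace ℝ (Fin d)) (τ2 : ℝ)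
    (y : Fin ℓ → EuclideanSpace ℝ (Fin d)) (s : Fin ℓ → ℝ) : ℝ :=
  (sbar ℓ τ2 s / (τ2 * ∏ u, (2 * π * s u))) ^ ((d : ℝ) / 2) *
    Real.exp (-Dfac d ℓ ν τ2 y s)

/-- Weighted sums of squared distances to a point split into the distance to the barycenter and
the weighted pairwise distances. -/
lemma sum_mul_norm_sub_sq {ι E : Type*} [Fintype ι] [NormedAddCommGroup E] [InnerProductSpace ℝ E]
    (w : ι → ℝ) (x : ι → E) (θ : E) (hw : ∑ i, w i ≠ 0) :
    ∑ i, w i * ‖x i - θ‖ ^ 2 =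
      (∑ i, w i) * ‖θ - (∑ i, w i)⁻¹ • ∑ i, w i • x i‖ ^ 2 +
        (∑ i, w i)⁻¹ / 2 * ∑ i, ∑ j, w i * w j * ‖x i - x j‖ ^ 2 := by
  have h₁ : ∑ i, w i * ‖x i - θ‖ ^ 2 =
      ∑ i, w i * ‖x i‖ ^ 2 - 2 * inner ℝ (∑ i, w i • x i) θ + (∑ i, w i) * ‖θ‖ ^ 2 := by
    rw [sum_inner, Finset.mul_sum, Finset.sum_mul, ← Finset.sum_sub_distrib,
      ← Finset.sum_add_distrib]
    refine Finset.sum_congr rfl fun i _ => ?_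
    rw [norm_sub_sq_real, real_inner_smul_left]
    ring
  have h₂ : ∑ i, ∑ j, w i * w j * ‖x i - x j‖ ^ 2 =
      2 * (∑ i, w i) * ∑ i, w i * ‖x i‖ ^ 2 - 2 * ‖∑ i, w i • x i‖ ^ 2 := by
    have h₃ : ‖∑ i, w i • x i‖ ^ 2 = ∑ i, ∑ j, w i * w j * inner ℝ (x i) (x j) := by
      rw [← real_inner_self_eq_norm_sq, sum_inner]
      refine Finset.sum_congr rfl fun i _ => ?_
      rw [inner_sum]
      refine Finset.sum_congr rfl fun j _ => ?_
      rw [real_inner_smul_left, real_inner_smul_right]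
      ring
    have h₄ : (∑ i, w i) * ∑ i, w i * ‖x i‖ ^ 2 = ∑ i, ∑ j, w i * w j * ‖x j‖ ^ 2 := by
      simp only [Finset.sum_mul_sum, mul_assoc]
    have h₅ : (∑ i, w i) * ∑ i, w i * ‖x i‖ ^ 2 = ∑ i, ∑ j, w i * w j * ‖x i‖ ^ 2 := by
      rw [h₄, Finset.sum_comm]
      simp only [mul_comm (w _) (w _)]
    have h₆ : 2 * (∑ i, w i) * ∑ i, w i * ‖x i‖ ^ 2 =
        ∑ i, ∑ j, w i * w j * ‖x i‖ ^ 2 + ∑ i, ∑ j, w i * w j * ‖x j‖ ^ 2 := by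
      rw [← h₄, ← h₅]
      ring
    rw [h₆, h₃]
    simp only [Finset.mul_sum, ← Finset.sum_sub_distrib, ← Finset.sum_add_distrib]
    refine Finset.sum_congr rfl fun i _ => Finset.sum_congr rfl fun j _ => ?_
    rw [norm_sub_sq_real]
    ring
  rw [h₁, h₂, norm_sub_sq_real, real_inner_smul_right, norm_smul, mul_pow, Real.norm_eq_abs,
    sq_abs, real_inner_comm θ]
  field_simp
  ring

/-- A symmetric double sum vanishing on the diagonal is twice its strictly upper part. -/
lemma sum_sum_eq_two_mul_sum_lt {ι : Type*} [Fintype ι] [LinearOrder ι] (f : ι → ι → ℝ)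
    (hsymm : ∀ i j, f i j = f j i) (hdiag : ∀ i, f i i = 0) :
    ∑ i, ∑ j, f i j = 2 * ∑ i, ∑ j, if i < j then f i j else 0 := by
  have h : ∑ i, ∑ j, f i j =
      ∑ i, ∑ j, (if i < j then f i j else 0) + ∑ i, ∑ j, (if j < i then f j i else 0) := by
    simp only [← Finset.sum_add_distrib]
    refine Finset.sum_congr rfl fun i _ => Finset.sum_congr rfl fun j _ => ?_
    rcases lt_trichotomy i j with h | rfl | h
    · simp [h, h.not_gt]
    · simp [hdiag]
    · simp [h, h.not_gt, hsymm i j]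
  rw [h, Finset.sum_comm (f := fun i j => if j < i then f j i else 0)]
  ring

lemma sbar_pos {ℓ : ℕ} {τ2 : ℝ} {s : Fin ℓ → ℝ} (hτ : 0 < τ2) (hs : ∀ u, 0 < s u) :
    0 < sbar ℓ τ2 s :=
  inv_pos.2 <| add_pos_of_pos_of_nonneg (one_div_pos.2 hτ) <|
    Finset.sum_nonneg fun u _ => (one_div_pos.2 (hs u)).le

/-- Completing the square in the exponent of the joint density. -/
lemma exponent_eq {d ℓ : ℕ} (ν : EuclideanSpace ℝ (Fin d)) {τ2 : ℝ} (hτ : 0 < τ2)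
    (y : Fin ℓ → EuclideanSpace ℝ (Fin d)) {s : Fin ℓ → ℝ} (hs : ∀ u, 0 < s u)
    (θ : EuclideanSpace ℝ (Fin d)) :
    ‖θ - ν‖ ^ 2 / (2 * τ2) + ∑ u, ‖y u - θ‖ ^ 2 / (2 * s u) =
      ‖θ - mubar d ℓ ν τ2 y s‖ ^ 2 / (2 * sbar ℓ τ2 s) + Dfac d ℓ ν τ2 y s := by
  have hpos := sbar_pos hτ hs
  have hW : ∑ i : Option (Fin ℓ), i.elim (1 / τ2) (fun u => 1 / s u) = (sbar ℓ τ2 s)⁻¹ := by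
    simp [Fintype.sum_option, sbar]
  have key := sum_mul_norm_sub_sq (fun i : Option (Fin ℓ) => i.elim (1 / τ2) (fun u => 1 / s u))
    (fun i => i.elim ν y) θ (by rw [hW]; exact (inv_pos.2 hpos).ne')
  rw [hW] at key
  simp only [Fintype.sum_option, Option.elim, inv_inv, sub_self, norm_zero, ne_eq,
    OfNat.ofNat_ne_zero, not_false_eq_true, zero_pow, mul_zero, zero_add,
    Finset.sum_add_distrib] at key
  rw [sum_sum_eq_two_mul_sum_lt (fun u v => 1 / s u * (1 / s v) * ‖y u - y v‖ ^ 2)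
    (fun u v => by rw [norm_sub_rev, mul_comm (1 / s u)]) (by simp)] at key
  have h₁ : ∑ u, 1 / s u * ‖y u - θ‖ ^ 2 = 2 * ∑ u, ‖y u - θ‖ ^ 2 / (2 * s u) := by
    rw [Finset.mul_sum]
    refine Finset.sum_congr rfl fun u _ => ?_
    have := (hs u).ne'
    field_simp
  have h₂ : ∑ u, 1 / τ2 * (1 / s u) * ‖ν - y u‖ ^ 2 = ∑ u, ‖y u - ν‖ ^ 2 / (s u * τ2) := by
    refine Finset.sum_congr rfl fun u _ => ?_
    have := (hs u).ne'
    rw [norm_sub_rev]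
    field_simp
  have h₃ : ∑ u, 1 / s u * (1 / τ2) * ‖y u - ν‖ ^ 2 = ∑ u, ‖y u - ν‖ ^ 2 / (s u * τ2) := by
    refine Finset.sum_congr rfl fun u _ => ?_
    have := (hs u).ne'
    field_simp
  have h₄ : (∑ u, ∑ v, if u < v then 1 / s u * (1 / s v) * ‖y u - y v‖ ^ 2 else 0) =
      ∑ u, ∑ v, if u < v then ‖y u - y v‖ ^ 2 / (s u * s v) else 0 := by
    refine Finset.sum_congr rfl fun u _ => Finset.sum_congr rfl fun v _ => ?_
    have := (hs u).ne'
    have := (hs v).ne'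
    congr 1
    field_simp
  rw [h₁, h₂, h₃, h₄, norm_sub_rev ν θ] at key
  rw [mubar, Dfac]
  linear_combination key / 2

/-- The joint density of the location and the observations factors into the posterior density
and the normalization factor. -/
lemma phi_mul_prod_phi {d ℓ : ℕ} (ν : EuclideanSpace ℝ (Fin d)) {τ2 : ℝ} (hτ : 0 < τ2)
    (y : Fin ℓ → EuclideanSpace ℝ (Fin d)) {s : Fin ℓ → ℝ} (hs : ∀ u, 0 < s u)
    (θ : EuclideanSpace ℝ (Fin d)) :
    phi d θ ν τ2 * ∏ u, phi d (y u) θ (s u) =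
      phi d θ (mubar d ℓ ν τ2 y s) (sbar ℓ τ2 s) * Cfac d ℓ ν τ2 y s := by
  have hpos := sbar_pos hτ hs
  have hs' : ∀ u, 0 < 2 * π * s u := fun u => by have := hs u; positivity
  have hprod : 0 < ∏ u, (2 * π * s u) := Finset.prod_pos fun u _ => hs' u
  have hconst : (2 * π * τ2) ^ (-(d : ℝ) / 2) * ∏ u, (2 * π * s u) ^ (-(d : ℝ) / 2) =
      (2 * π * sbar ℓ τ2 s) ^ (-(d : ℝ) / 2) *
        (sbar ℓ τ2 s / (τ2 * ∏ u, (2 * π * s u))) ^ ((d : ℝ) / 2) := by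
    rw [Real.finsetProd_rpow _ _ fun u _ => (hs' u).le, ← Real.mul_rpow (by positivity) hprod.le,
      neg_div, Real.rpow_neg (by positivity), Real.rpow_neg (by positivity),
      ← Real.inv_rpow (by positivity), ← Real.inv_rpow (by positivity),
      ← Real.mul_rpow (by positivity) (by positivity)]
    congr 1
    field_simp
  have hexp : Real.exp (-‖θ - ν‖ ^ 2 / (2 * τ2)) * ∏ u, Real.exp (-‖y u - θ‖ ^ 2 / (2 * s u)) =
      Real.exp (-‖θ - mubar d ℓ ν τ2 y s‖ ^ 2 / (2 * sbar ℓ τ2 s)) *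
        Real.exp (-Dfac d ℓ ν τ2 y s) := by
    rw [← Real.exp_sum, ← Real.exp_add, ← Real.exp_add]
    congr 1
    simp only [neg_div, Finset.sum_neg_distrib]
    linear_combination -exponent_eq ν hτ y hs θ
  unfold phi Cfac
  rw [Finset.prod_mul_distrib, mul_mul_mul_comm, hconst, hexp, mul_mul_mul_comm]

lemma integral_phi (d : ℕ) (m : EuclideanSpace ℝ (Fin d)) {s : ℝ} (hs : 0 < s) :
    ∫ x, phi d x m s = 1 := by
  have h := GaussianFourier.integral_rexp_neg_mul_sq_norm (V := EuclideanSpace ℝ (Fin d))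
    (b := 1 / (2 * s)) (by positivity)
  rw [← integral_sub_right_eq_self _ m] at h
  have h' : ∀ x, phi d x m s =
      (2 * π * s) ^ (-(d : ℝ) / 2) * Real.exp (-(1 / (2 * s)) * ‖x - m‖ ^ 2) := fun x => by
    rw [phi]
    congr 2
    ring
  simp only [h']
  rw [integral_const_mul, h, finrank_euclideanSpace_fin, neg_div, Real.rpow_neg (by positivity),
    show π / (1 / (2 * s)) = 2 * π * s by field_simp]
  exact inv_mul_cancel₀ (by positivity)

lemma integrable_phi (d : ℕ) (m : EuclideanSpace ℝ (Fin d)) {s : ℝ} (hs : 0 < s) :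
    Integrable fun x => phi d x m s :=
  Integrable.of_integral_ne_zero (by rw [integral_phi d m hs]; exact one_ne_zero)

lemma phi_nonneg (d : ℕ) (x m : EuclideanSpace ℝ (Fin d)) {s : ℝ} (hs : 0 < s) :
    0 ≤ phi d x m s := by
  unfold phi
  positivity

lemma integral_prod_phi {d ℓ : ℕ} (θ : EuclideanSpace ℝ (Fin d)) {s : Fin ℓ → ℝ}
    (hs : ∀ u, 0 < s u) :
    ∫ y : Fin ℓ → EuclideanSpace ℝ (Fin d), ∏ u, phi d (y u) θ (s u) = 1 := by
  rw [integral_fintype_prod_volume_eq_prod (fun u x => phi d x θ (s u))]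
  exact Finset.prod_eq_one fun u _ => integral_phi d θ (hs u)

lemma integrable_joint {d ℓ : ℕ} (ν : EuclideanSpace ℝ (Fin d)) {τ2 : ℝ} (hτ : 0 < τ2)
    {s : Fin ℓ → ℝ} (hs : ∀ u, 0 < s u) :
    Integrable fun p : EuclideanSpace ℝ (Fin d) × (Fin ℓ → EuclideanSpace ℝ (Fin d)) =>
      phi d p.1 ν τ2 * ∏ u, phi d (p.2 u) p.1 (s u) := by
  have hcont : Continuous fun p : EuclideanSpace ℝ (Fin d) × (Fin ℓ → EuclideanSpace ℝ (Fin d)) =>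
      phi d p.1 ν τ2 * ∏ u, phi d (p.2 u) p.1 (s u) := by
    unfold phi
    fun_prop
  refine (integrable_prod_iff hcont.aestronglyMeasurable).2 ⟨.of_forall fun θ => ?_, ?_⟩
  · have h : Integrable fun y : Fin ℓ → EuclideanSpace ℝ (Fin d) => ∏ u, phi d (y u) θ (s u) :=
      Integrable.of_integral_ne_zero (by rw [integral_prod_phi θ hs]; exact one_ne_zero)
    exact h.const_mul (phi d θ ν τ2)
  · have h : ∀ θ : EuclideanSpace ℝ (Fin d), ∀ y : Fin ℓ → EuclideanSpace ℝ (Fin d),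
        ‖phi d θ ν τ2 * ∏ u, phi d (y u) θ (s u)‖ =
          phi d θ ν τ2 * ∏ u, phi d (y u) θ (s u) := fun θ y =>
      Real.norm_of_nonneg <| mul_nonneg (phi_nonneg d θ ν hτ) <|
        Finset.prod_nonneg fun u _ => phi_nonneg d (y u) θ (hs u)
    simp only [h, integral_const_mul, integral_prod_phi _ hs, mul_one]
    exact integrable_phi d ν hτ

/-- `y ↦ C(y,s)` is a probability density on `(ℝ^d)^ℓ`:
`∫_{(ℝ^d)^ℓ} C(y,s) dy = 1`. -/
theorem statement2 (d ℓ : ℕ) (hd : 1 ≤ d) (hℓ : 1 ≤ ℓ)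
    (ν : EuclideanSpace ℝ (Fin d)) (τ2 : ℝ) (hτ : 0 < τ2)
    (s : Fin ℓ → ℝ) (hs : ∀ u, 0 < s u) :
    ∫ y : Fin ℓ → EuclideanSpace ℝ (Fin d), Cfac d ℓ ν τ2 y s = 1 := by
  calc ∫ y : Fin ℓ → EuclideanSpace ℝ (Fin d), Cfac d ℓ ν τ2 y s
      = ∫ y : Fin ℓ → EuclideanSpace ℝ (Fin d), ∫ θ : EuclideanSpace ℝ (Fin d),
          phi d θ ν τ2 * ∏ u, phi d (y u) θ (s u) := by
        simp only [phi_mul_prod_phi ν hτ _ hs, integral_mul_const,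
          integral_phi d _ (sbar_pos hτ hs), one_mul]
    _ = ∫ θ : EuclideanSpace ℝ (Fin d), ∫ y : Fin ℓ → EuclideanSpace ℝ (Fin d),
          phi d θ ν τ2 * ∏ u, phi d (y u) θ (s u) :=
        (integral_integral_swap (integrable_joint ν hτ hs)).symm
    _ = 1 := by
        simp only [integral_const_mul, integral_prod_phi _ hs, mul_one, integral_phi d ν hτ]
end
end

section
/- Let (Ω, P) be a probability space, let T be a nonempty finite index set, let t̃ ∈ T, and let (b_t)_{t∈T} be measurable random variables with values in [0,1] such that Σ_{t∈T} b_t = 1 almost surely. Then Σ_{t∈T} Σ_{s∈T, s≠t̃} ( E[(b_s · b_t)²] )^{1/2} ≤ |T|^{3/2} · (1 − E[b_{t̃}])^{1/4}. (Collapse inequality for belief weights: if on average the belief concentrates on the true index t̃, all cross second moments involving a wrong index are jointly small.) -/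
open MeasureTheory ProbabilityTheory Real

noncomputable section

/-- collapse inequality for belief weights: if `(b_t)_{t∈T}` are `[0,1]`-valued
random variables summing to `1` a.s., then
`Σ_{t∈T} Σ_{s≠t̃} √E[(b_s b_t)²] ≤ |T|^{3/2} (1 − E[b_{t̃}])^{1/4}`. -/
theorem statement10 {Ω : Type*} [MeasurableSpace Ω] (P : Measure Ω) [IsProbabilityMeasure P]
    (T : Type*) [Fintype T] [DecidableEq T] [Nonempty T] (t0 : T)
    (b : T → Ω → ℝ) (hb_meas : ∀ t, Measurable (b t))
    (hb01 : ∀ t ω, b t ω ∈ Set.Icc (0 : ℝ) 1)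
    (hb_sum : ∀ᵐ ω ∂P, ∑ t, b t ω = 1) :
    ∑ t, ∑ s ∈ Finset.univ.erase t0, Real.sqrt (∫ ω, (b s ω * b t ω) ^ 2 ∂P) ≤
      (Fintype.card T : ℝ) ^ ((3 : ℝ) / 2) * (1 - ∫ ω, b t0 ω ∂P) ^ ((1 : ℝ) / 4) := by
  have integrable_b : ∀ t, Integrable (b t) P := fun t =>
    Integrable.of_bound (hb_meas t).aestronglyMeasurable 1
      (ae_of_all _ fun ω => by
        rw [Real.norm_of_nonneg (hb01 t ω).1]; exact (hb01 t ω).2)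
  have integrable_sq : ∀ s t, Integrable (fun ω => (b s ω * b t ω) ^ 2) P := fun s t =>
    Integrable.of_bound (((hb_meas s).mul (hb_meas t)).pow_const 2).aestronglyMeasurable 1
      (ae_of_all _ fun ω => by
        rw [Real.norm_of_nonneg (sq_nonneg _)]
        exact pow_le_one₀ (mul_nonneg (hb01 s ω).1 (hb01 t ω).1)
          (mul_le_one₀ (hb01 s ω).2 (hb01 t ω).1 (hb01 t ω).2))
  set δ : ℝ := 1 - ∫ ω, b t0 ω ∂P with hδ
  have hδ_eq : ∫ ω, (1 - b t0 ω) ∂P = δ := by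
    rw [integral_sub (integrable_const 1) (integrable_b t0)]
    simp [hδ]
  have hδ0 : 0 ≤ δ := by
    rw [← hδ_eq]
    exact integral_nonneg fun ω => sub_nonneg.2 (hb01 t0 ω).2
  have hδ1 : δ ≤ 1 := by
    have : 0 ≤ ∫ ω, b t0 ω ∂P := integral_nonneg fun ω => (hb01 t0 ω).1
    linarith
  have hn : (1 : ℝ) ≤ Fintype.card T := by exact_mod_cast Fintype.card_pos (α := T)
  set n := (Fintype.card T : ℝ)
  set A : Finset (T × T) := Finset.univ ×ˢ Finset.univ.erase t0
  have hmoment : ∑ x ∈ A, ∫ ω, (b x.2 ω * b x.1 ω) ^ 2 ∂P ≤ δ := by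
    rw [← integral_finsetSum _ fun x _ => integrable_sq x.2 x.1, ← hδ_eq]
    refine integral_mono_ae (integrable_finsetSum _ fun x _ => integrable_sq x.2 x.1)
      ((integrable_const 1).sub (integrable_b t0)) ?_
    filter_upwards [hb_sum] with ω hω
    have hle : ∀ x ∈ A, (b x.2 ω * b x.1 ω) ^ 2 ≤ b x.1 ω * b x.2 ω := fun x _ => by
      have h0 := mul_nonneg (hb01 x.2 ω).1 (hb01 x.1 ω).1
      have h1 := mul_le_one₀ (hb01 x.2 ω).2 (hb01 x.1 ω).1 (hb01 x.1 ω).2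
      nlinarith
    refine (Finset.sum_le_sum hle).trans_eq ?_
    rw [Finset.sum_product]
    dsimp only
    rw [← Finset.sum_mul_sum, hω, one_mul, eq_sub_iff_add_eq, ← hω]
    exact Finset.sum_erase_add _ _ (Finset.mem_univ t0)
  have hcard : (A.card : ℝ) ≤ n ^ 2 := by
    have : A.card ≤ Fintype.card T * Fintype.card T := by
      simpa using Finset.card_le_univ A
    change (A.card : ℝ) ≤ (Fintype.card T : ℝ) ^ 2
    rw [sq]
    exact_mod_cast this
  have hsum : ∑ x ∈ A, √(∫ ω, (b x.2 ω * b x.1 ω) ^ 2 ∂P) ≤ n * √δ := by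
    refine abs_le_of_sq_le_sq' ?_ (by positivity) |>.2
    calc (∑ x ∈ A, √(∫ ω, (b x.2 ω * b x.1 ω) ^ 2 ∂P)) ^ 2
        ≤ A.card * ∑ x ∈ A, √(∫ ω, (b x.2 ω * b x.1 ω) ^ 2 ∂P) ^ 2 :=
          sq_sum_le_card_mul_sum_sq
      _ = A.card * ∑ x ∈ A, ∫ ω, (b x.2 ω * b x.1 ω) ^ 2 ∂P := by
          congr 1
          exact Finset.sum_congr rfl fun x _ =>
            Real.sq_sqrt (integral_nonneg fun ω => sq_nonneg _)
      _ ≤ A.card * δ := by gcongr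
      _ ≤ n ^ 2 * δ := by gcongr
      _ = (n * √δ) ^ 2 := by rw [mul_pow, Real.sq_sqrt hδ0]
  rw [← Finset.sum_product']
  refine hsum.trans (mul_le_mul ?_ ?_ (by positivity) (by positivity))
  · exact Real.self_le_rpow_of_one_le hn (by norm_num)
  · rw [Real.sqrt_eq_rpow]
    exact Real.rpow_le_rpow_of_exponent_ge_of_imp hδ0 hδ1 (by norm_num) (by norm_num)
end
end
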